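/- Fix L > 0 and β₀, β₁ ∈ ℂ with β₀β₁ ≠ 0 and β₀ + β₁ ≠ 0. Let κ ∈ ℝ satisfy 2(β₀ + β₁)cos(κL) = 2(1 + β₀β₁) and sin(κL) ≠ 0, set γ = exp(iκL), and assume 1/conj(β₁) ≠ γ⁻¹. Define Y : ℝ → ℂ by Y(x) = e^{iκx} + ((γ − 1/conj(β₁))/(1/conj(β₁) − γ⁻¹)) e^{−iκx}. Then Y''(x) + κ²Y(x) = 0 for all x ∈ ℝ, Y(0) = conj(β₁)·Y(L), and Y'(0) = conj(β₀)·Y'(L). -/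

import Mathlib

lemma hasDerivAt_exp_add_mul_exp_neg (a b w : ℂ) (x : ℝ) :
    HasDerivAt (fun t : ℝ => a * Complex.exp (w * (t : ℂ)) + b * Complex.exp (-(w * (t : ℂ))))
      ((w * a) * Complex.exp (w * (x : ℂ)) + (-(w * b)) * Complex.exp (-(w * (x : ℂ)))) x := by
  have hlin : HasDerivAt (fun t : ℝ => w * (t : ℂ)) w x := by
    simpa using (Complex.ofRealCLM.hasDerivAt (x := x)).const_mul w
  refine ((hlin.cexp.const_mul a).add (hlin.neg.cexp.const_mul b)).congr_deriv ?_
  simp only [Pi.neg_apply]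
  ring

lemma deriv_exp_add_mul_exp_neg (a b w : ℂ) :
    deriv (fun t : ℝ => a * Complex.exp (w * (t : ℂ)) + b * Complex.exp (-(w * (t : ℂ)))) =
      fun x : ℝ =>
        (w * a) * Complex.exp (w * (x : ℂ)) + (-(w * b)) * Complex.exp (-(w * (x : ℂ))) :=
  funext fun x => (hasDerivAt_exp_add_mul_exp_neg a b w x).deriv


/-- At each real zero `κ` of the discriminant with `sin(κL) ≠ 0`, the function
`Y(x) = e^{iκx} + ((γ−1/conj(β₁))/(1/conj(β₁)−γ⁻¹)) e^{−iκx}`, with `γ = e^{iκL}`,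
is an eigenfunction of the adjoint pseudoperiodic problem. -/
theorem adjoint_pseudoperiodic_eigenfunction (L : ℝ) (hL : 0 < L) (β₀ β₁ : ℂ)
    (hβ01 : β₀ * β₁ ≠ 0) (hs : β₀ + β₁ ≠ 0) (κ : ℝ)
    (hκ : 2 * (β₀ + β₁) * Complex.cos ((κ : ℂ) * (L : ℂ)) = 2 * (1 + β₀ * β₁))
    (hsin : Complex.sin ((κ : ℂ) * (L : ℂ)) ≠ 0)
    (γ : ℂ) (hγ : γ = Complex.exp (Complex.I * (κ : ℂ) * (L : ℂ)))
    (hβ : 1 / (starRingEnd ℂ) β₁ ≠ γ⁻¹)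
    (Y : ℝ → ℂ)
    (hY : ∀ x : ℝ, Y x = Complex.exp (Complex.I * (κ : ℂ) * (x : ℂ)) +
      ((γ - 1 / (starRingEnd ℂ) β₁) / (1 / (starRingEnd ℂ) β₁ - γ⁻¹)) *
        Complex.exp (-(Complex.I * (κ : ℂ) * (x : ℂ)))) :
    (∀ x : ℝ, deriv (deriv Y) x + (κ : ℂ) ^ 2 * Y x = 0) ∧
      Y 0 = (starRingEnd ℂ) β₁ * Y L ∧
      deriv Y 0 = (starRingEnd ℂ) β₀ * deriv Y L := by
  have hγ0 : γ ≠ 0 := hγ ▸ Complex.exp_ne_zero _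
  have hγinv : Complex.exp (-(Complex.I * (κ : ℂ) * (L : ℂ))) = γ⁻¹ := by
    rw [Complex.exp_neg, hγ]
  have hcos : 2 * Complex.cos ((κ : ℂ) * (L : ℂ)) = γ + γ⁻¹ := by
    rw [Complex.two_cos, ← hγinv, hγ]
    congr 2 <;> ring
  have hconj : (starRingEnd ℂ) (Complex.cos ((κ : ℂ) * (L : ℂ))) =
      Complex.cos ((κ : ℂ) * (L : ℂ)) := by
    rw [← Complex.cos_conj, map_mul, Complex.conj_ofReal, Complex.conj_ofReal]
  have hκ' := congrArg (starRingEnd ℂ) hκ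
  simp only [map_mul, map_add, map_one, map_ofNat, hconj] at hκ'
  have hβ1 : (starRingEnd ℂ) β₁ ≠ 0 :=
    (map_ne_zero _).2 (right_ne_zero_of_mul hβ01)
  generalize (starRingEnd ℂ) β₀ = B₀ at *
  generalize (starRingEnd ℂ) β₁ = B₁ at *
  have hdisc : (B₀ + B₁) * (γ + γ⁻¹) = 2 * (1 + B₀ * B₁) := by
    rw [← hcos, ← hκ']
    ring
  have hD : 1 / B₁ - γ⁻¹ ≠ 0 := sub_ne_zero.2 hβ
  set c := (γ - 1 / B₁) / (1 / B₁ - γ⁻¹) with hc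
  have hcD : c * (1 / B₁ - γ⁻¹) = γ - 1 / B₁ := div_mul_cancel₀ _ hD
  clear_value c
  obtain rfl : Y = fun x : ℝ => 1 * Complex.exp (Complex.I * (κ : ℂ) * (x : ℂ)) +
      c * Complex.exp (-(Complex.I * (κ : ℂ) * (x : ℂ))) := by
    funext x
    rw [hY, one_mul]
  simp only [deriv_exp_add_mul_exp_neg, hγinv, ← hγ, Complex.ofReal_zero, mul_zero, neg_zero,
    Complex.exp_zero]
  have hB : B₁ * (1 / B₁) = 1 := mul_one_div_cancel hβ1
  have hg : γ * γ⁻¹ = 1 := mul_inv_cancel₀ hγ0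
  generalize 1 / B₁ = b at *
  generalize γ⁻¹ = g at *
  refine ⟨fun x => ?_, ?_, ?_⟩
  · linear_combination (κ : ℂ) ^ 2 * (Complex.exp (Complex.I * (κ : ℂ) * (x : ℂ)) +
      c * Complex.exp (-(Complex.I * (κ : ℂ) * (x : ℂ)))) * Complex.I_sq
  · linear_combination B₁ * hcD - (1 + c) * hB
  · have key : 1 - c = B₀ * (γ - c * g) := by
      apply mul_right_cancel₀ hD
      apply mul_left_cancel₀ hβ1
      linear_combination (-B₁) * (1 - B₀ * g) * hcD - hdisc + (2 - B₀ * (γ + g)) * hB +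
        2 * B₀ * B₁ * hg
    linear_combination Complex.I * (κ : ℂ) * key
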